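/- Let G be a finite connected weighted graph with more than one vertex, Laplacian L defined by (Lf)(v) = Σ_u (f(v) − f(u)) w(v,u), first nonzero eigenvalue λ₁, and φ₀ = χ_G/√|G| the normalized constant eigenfunction. Let ψ ∈ ℓ²(G) satisfy ⟨ψ, φ₀⟩ ≠ 0. Then for every f ∈ ℓ²(G) orthogonal to ψ, ‖f‖²_{ℓ²(G)} ≤ (θ/λ₁) ‖∇f‖²_{ℓ²(G)}, where θ = ‖ψ‖²/|⟨ψ, φ₀⟩|² and ‖∇f‖² = (1/2) Σ_{u,v} |f(u)−f(v)|² w(u,v). -/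

import Mathlib

open Finset

/-- Weighted gradient norm squared: `‖∇f‖² = (1/2) Σ_{u,v} |f(u)−f(v)|² w(u,v)`. -/
noncomputable def gradSq {V : Type*} [Fintype V] (w : V → V → ℝ) (f : V → ℂ) : ℝ :=
  (1 / 2) * ∑ u, ∑ v, ‖f u - f v‖ ^ 2 * w u v

/-- Weighted graph Laplacian: `(Lf)(v) = Σ_u (f(v) − f(u)) w(v,u)`. -/
noncomputable def lap {V : Type*} [Fintype V] (w : V → V → ℝ) (f : V → ℂ) : V → ℂ :=
  fun v => ∑ u, (f v - f u) * ((w v u : ℝ) : ℂ)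

/-- Inner product on `ℓ²(G)`. -/
noncomputable def ip {V : Type*} [Fintype V] (ψ f : V → ℂ) : ℂ :=
  ∑ v, (starRingEnd ℂ) (ψ v) * f v

/-- Squared `ℓ²(G)` norm. -/
noncomputable def nsq {V : Type*} [Fintype V] (f : V → ℂ) : ℝ :=
  ∑ v, ‖f v‖ ^ 2

/-- The graph with weight `w` is connected. -/
def GraphConnected {V : Type*} [Fintype V] (w : V → V → ℝ) : Prop :=
  ∀ u v : V, Relation.ReflTransGen (fun a b => 0 < w a b) u v

/-- `lam1` is the first (smallest) nonzero eigenvalue of the Laplacian of `(V, w)`. -/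
def IsFirstNonzeroEig {V : Type*} [Fintype V] (w : V → V → ℝ) (lam1 : ℝ) : Prop :=
  0 < lam1 ∧
  (∃ φ : V → ℂ, φ ≠ 0 ∧ lap w φ = fun v => (lam1 : ℂ) * φ v) ∧
  ∀ (μ : ℝ) (φ : V → ℂ), φ ≠ 0 → (lap w φ = fun v => (μ : ℂ) * φ v) → μ = 0 ∨ lam1 ≤ μ

lemma aux_proj {H : Type*} [NormedAddCommGroup H] [InnerProductSpace ℂ H] (f ψ φ : H)
    (hφ : ‖φ‖ = 1) (h : inner ℂ ψ f = 0) :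
    ‖f‖ ^ 2 * ‖inner ℂ ψ φ‖ ^ 2 ≤ ‖ψ‖ ^ 2 * ‖f - (inner ℂ φ f) • φ‖ ^ 2 := by
  by_cases hf0 : f = 0
  · subst hf0
    simp
  have hfp : 0 < ‖f‖ ^ 2 := by positivity
  have hg : ‖f - (inner ℂ φ f) • φ‖ ^ 2 = ‖f‖ ^ 2 - ‖inner ℂ φ f‖ ^ 2 := by
    rw [@norm_sub_sq ℂ, norm_smul, hφ, inner_smul_right, ← inner_conj_symm f φ, RCLike.mul_conj]
    norm_cast
    simp
    ring
  have hh : ‖((‖f‖ ^ 2 : ℝ) : ℂ) • φ - (inner ℂ f φ) • f‖ ^ 2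
      = ‖f‖ ^ 2 * (‖f‖ ^ 2 - ‖inner ℂ φ f‖ ^ 2) := by
    rw [@norm_sub_sq ℂ, norm_smul, norm_smul, hφ, inner_smul_right, inner_smul_left,
      ← inner_conj_symm φ f, Complex.conj_ofReal, mul_left_comm, RCLike.mul_conj, RCLike.norm_conj]
    have hre : RCLike.re (((‖f‖ ^ 2 : ℝ) : ℂ) * ((‖inner ℂ f φ‖ : ℝ) : ℂ) ^ 2)
        = ‖f‖ ^ 2 * ‖inner ℂ f φ‖ ^ 2 := by
      rw [← Complex.ofReal_pow, ← Complex.ofReal_mul]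
      exact Complex.ofReal_re _
    erw [hre]
    rw [Complex.norm_real, Real.norm_of_nonneg hfp.le]
    ring
  have hip : inner ℂ ψ (((‖f‖ ^ 2 : ℝ) : ℂ) • φ - (inner ℂ f φ) • f)
      = ((‖f‖ ^ 2 : ℝ) : ℂ) * inner ℂ ψ φ := by
    rw [inner_sub_right, inner_smul_right, inner_smul_right, h]
    simp
  have cs := norm_inner_le_norm (𝕜 := ℂ) ψ (((‖f‖ ^ 2 : ℝ) : ℂ) • φ - (inner ℂ f φ) • f)
  have cs2 := pow_le_pow_left₀ (norm_nonneg _) cs 2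
  rw [mul_pow, hh, hip, norm_mul, Complex.norm_real, Real.norm_of_nonneg hfp.le] at cs2
  rw [hg]
  refine le_of_mul_le_mul_left ?_ hfp
  nlinarith

lemma ip_eq {V : Type*} [Fintype V] (a b : V → ℂ) :
    ip a b = inner ℂ (WithLp.toLp 2 a : EuclideanSpace ℂ V) (WithLp.toLp 2 b) := by
  simp [ip, PiLp.inner_apply, mul_comm]

lemma nsq_eq {V : Type*} [Fintype V] (a : V → ℂ) :
    nsq a = ‖(WithLp.toLp 2 a : EuclideanSpace ℂ V)‖ ^ 2 := by
  simp [nsq, EuclideanSpace.norm_sq_eq]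

lemma lap_bilin {V : Type*} [Fintype V] (w : V → V → ℝ) (hsymm : ∀ u v, w u v = w v u)
    (f g : V → ℂ) : ip f (lap w g) =
      (1 / 2) * ∑ u, ∑ v, (starRingEnd ℂ) (f u - f v) * (g u - g v) * (w u v : ℂ) := by
  have h1 : ip f (lap w g) = ∑ u, ∑ v, (starRingEnd ℂ) (f u) * (g u - g v) * (w u v : ℂ) := by
    simp only [ip, lap, Finset.mul_sum, mul_assoc]
  have h2 : ip f (lap w g) = ∑ u, ∑ v, - ((starRingEnd ℂ) (f v) * (g u - g v) * (w u v : ℂ)) := by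
    rw [h1, Finset.sum_comm]
    refine Finset.sum_congr rfl fun u _ => Finset.sum_congr rfl fun v _ => ?_
    rw [hsymm v u]
    ring
  have h3 : ∑ u, ∑ v, (starRingEnd ℂ) (f u - f v) * (g u - g v) * (w u v : ℂ)
      = ip f (lap w g) + ip f (lap w g) := by
    nth_rewrite 1 [h1]
    rw [h2]
    simp only [← Finset.sum_add_distrib]
    refine Finset.sum_congr rfl fun u _ => Finset.sum_congr rfl fun v _ => ?_
    rw [map_sub]
    ring
  rw [h3]
  ring

lemma lap_grad {V : Type*} [Fintype V] (w : V → V → ℝ) (hsymm : ∀ u v, w u v = w v u)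
    (f : V → ℂ) : ip f (lap w f) = (gradSq w f : ℂ) := by
  rw [lap_bilin w hsymm, gradSq]
  push_cast
  congr 1
  refine Finset.sum_congr rfl fun u _ => Finset.sum_congr rfl fun v _ => ?_
  rw [RCLike.conj_mul]
  simp

/-- The Laplacian as a linear map on Euclidean space. -/
noncomputable def lapLin {V : Type*} [Fintype V] (w : V → V → ℝ) :
    EuclideanSpace ℂ V →ₗ[ℂ] EuclideanSpace ℂ V where
  toFun x := WithLp.toLp 2 (lap w x.ofLp)
  map_add' x y := by
    ext v
    simp only [lap, PiLp.add_apply, WithLp.ofLp_add, Pi.add_apply, ← Finset.sum_add_distrib]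
    exact Finset.sum_congr rfl fun u _ => by ring
  map_smul' c x := by
    ext v
    simp only [lap, PiLp.smul_apply, WithLp.ofLp_smul, Pi.smul_apply, smul_eq_mul,
      Finset.mul_sum, RingHom.id_apply]
    exact Finset.sum_congr rfl fun u _ => by ring

lemma lapLin_symm {V : Type*} [Fintype V] (w : V → V → ℝ) (hsymm : ∀ u v, w u v = w v u) :
    (lapLin w).IsSymmetric := by
  intro x y
  have h1 := ip_eq x.ofLp (lap w y.ofLp)
  have h2 := ip_eq y.ofLp (lap w x.ofLp)
  rw [← inner_conj_symm]
  change (starRingEnd ℂ) (inner ℂ (WithLp.toLp 2 y.ofLp) (WithLp.toLp 2 (lap w x.ofLp))) =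
    inner ℂ (WithLp.toLp 2 x.ofLp) (WithLp.toLp 2 (lap w y.ofLp))
  rw [← h1, ← h2, lap_bilin w hsymm, lap_bilin w hsymm]
  simp only [map_mul, map_sum, map_sub, Complex.conj_conj, Complex.conj_ofReal, map_div₀, map_one,
    map_ofNat]
  congr 1
  exact Finset.sum_congr rfl fun u _ => Finset.sum_congr rfl fun v _ => by ring

lemma const_of_ker {V : Type*} [Fintype V] (w : V → V → ℝ)
    (hsymm : ∀ u v, w u v = w v u) (hnn : ∀ u v, 0 ≤ w u v) (hconn : GraphConnected w)
    (φ : V → ℂ) (h : lap w φ = 0) : ∀ u v, φ u = φ v := by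
  have h0 : gradSq w φ = 0 := by
    have := lap_grad w hsymm φ
    rw [h] at this
    have h' : (gradSq w φ : ℂ) = 0 := by rw [← this]; simp [ip]
    exact_mod_cast h'
  have hs : ∑ u, ∑ v, ‖φ u - φ v‖ ^ 2 * w u v = 0 := by
    unfold gradSq at h0
    linarith
  have hz : ∀ u v, ‖φ u - φ v‖ ^ 2 * w u v = 0 := by
    intro u v
    have hp : ∀ a b, 0 ≤ ‖φ a - φ b‖ ^ 2 * w a b := fun a b =>
      mul_nonneg (by positivity) (hnn a b)
    have h1 := (Finset.sum_eq_zero_iff_of_nonneg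
      (fun a _ => Finset.sum_nonneg fun b _ => hp a b)).1 hs u (Finset.mem_univ _)
    exact (Finset.sum_eq_zero_iff_of_nonneg (fun b _ => hp u b)).1 h1 v (Finset.mem_univ _)
  intro u v
  induction hconn u v with
  | refl => rfl
  | @tail b c _ hbc ih =>
    rw [ih]
    rcases mul_eq_zero.1 (hz b c) with h | h
    · exact sub_eq_zero.1 (by simpa using h)
    · exact absurd h hbc.ne'

lemma poincare_zero_mean {V : Type*} [Fintype V] (w : V → V → ℝ)
    (hsymm : ∀ u v, w u v = w v u) (hnn : ∀ u v, 0 ≤ w u v) (hconn : GraphConnected w)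
    (lam1 : ℝ) (hlam : IsFirstNonzeroEig w lam1) (g : V → ℂ) (hg : ∑ v, g v = 0) :
    lam1 * nsq g ≤ gradSq w g := by
  have hT := lapLin_symm w hsymm
  have hn : Module.finrank ℂ (EuclideanSpace ℂ V) = Fintype.card V := finrank_euclideanSpace
  set b := hT.eigenvectorBasis hn with hb
  set x : EuclideanSpace ℂ V := WithLp.toLp 2 g with hx
  have e1 : (gradSq w g : ℂ) = ∑ i, ((hT.eigenvalues hn i * ‖inner ℂ (b i) x‖ ^ 2 : ℝ) : ℂ) := by
    rw [← lap_grad w hsymm, ip_eq]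
    change inner ℂ x (lapLin w x) = _
    rw [← b.sum_inner_mul_inner]
    refine Finset.sum_congr rfl fun i _ => ?_
    rw [← hT, hT.apply_eigenvectorBasis, inner_smul_left, ← inner_conj_symm x (b i)]
    rw [mul_left_comm, RCLike.conj_mul]
    simp [hb]
  have e2 : gradSq w g = ∑ i, hT.eigenvalues hn i * ‖inner ℂ (b i) x‖ ^ 2 := by
    exact_mod_cast e1
  rw [e2, nsq_eq, ← b.sum_sq_norm_inner_right x, Finset.mul_sum]
  refine Finset.sum_le_sum fun i _ => ?_
  have hbi : lap w (b i).ofLp = fun v => ((hT.eigenvalues hn i : ℝ) : ℂ) * (b i).ofLp v := by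
    have := congrArg WithLp.ofLp (hT.apply_eigenvectorBasis hn i)
    exact this
  have hne : (b i).ofLp ≠ 0 := by
    intro h
    apply b.toBasis.ne_zero i
    ext v
    simpa using congrFun h v
  rcases hlam.2.2 _ _ hne hbi with h | h
  · rw [h] at hbi
    have hc := const_of_ker w hsymm hnn hconn (b i).ofLp (by rw [hbi]; ext; simp)
    have : inner ℂ (b i) x = 0 := by
      have h1 := ip_eq (b i).ofLp g
      change _ = inner ℂ (b i) x at h1
      rw [← h1, ip]
      rcases isEmpty_or_nonempty V with hV | ⟨⟨v0⟩⟩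
      · simp
      · rw [Finset.sum_congr rfl (fun v _ => by rw [hc v v0]), ← Finset.mul_sum, hg, mul_zero]
    simp [this]
  · exact mul_le_mul_of_nonneg_right h (by positivity)

/-- Theorem 3.1: Poincaré inequality on a finite connected graph. If `⟨ψ, φ₀⟩ ≠ 0` and
`⟨ψ, f⟩ = 0` then `‖f‖² ≤ (θ/λ₁)‖∇f‖²` with `θ = ‖ψ‖²/|⟨ψ, φ₀⟩|²`. -/
theorem stmt2 {V : Type*} [Fintype V] (w : V → V → ℝ)
    (hsymm : ∀ u v, w u v = w v u) (hnn : ∀ u v, 0 ≤ w u v) (hdiag : ∀ v, w v v = 0)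
    (hconn : GraphConnected w) (hcard : 1 < Fintype.card V)
    (lam1 : ℝ) (hlam : IsFirstNonzeroEig w lam1)
    (φ0 : V → ℂ) (hφ0 : φ0 = fun _ => ((1 / Real.sqrt (Fintype.card V) : ℝ) : ℂ))
    (ψ : V → ℂ) (hnz : ip ψ φ0 ≠ 0)
    (f : V → ℂ) (hf : ip ψ f = 0) :
    nsq f ≤ (nsq ψ / ‖ip ψ φ0‖ ^ 2) / lam1 * gradSq w f := by
  have hn : (0 : ℝ) < Fintype.card V := by exact_mod_cast (by omega : 0 < Fintype.card V)
  have hl := hlam.1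
  have hnorm : ‖(WithLp.toLp 2 φ0 : EuclideanSpace ℂ V)‖ = 1 := by
    have : ‖(WithLp.toLp 2 φ0 : EuclideanSpace ℂ V)‖ ^ 2 = 1 := by
      rw [← nsq_eq, nsq, hφ0]
      simp only [Complex.norm_real, Real.norm_eq_abs, sq_abs, Finset.sum_const, Finset.card_univ,
        nsmul_eq_mul, div_pow, Real.sq_sqrt hn.le]
      field_simp
    exact (pow_eq_one_iff_of_nonneg (norm_nonneg _) two_ne_zero).1 this
  have key := aux_proj (WithLp.toLp 2 f : EuclideanSpace ℂ V) (WithLp.toLp 2 ψ)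
    (WithLp.toLp 2 φ0) hnorm (by rw [← ip_eq, hf])
  have hgdef : (WithLp.toLp 2 f : EuclideanSpace ℂ V) -
      (inner ℂ (WithLp.toLp 2 φ0 : EuclideanSpace ℂ V) (WithLp.toLp 2 f)) • WithLp.toLp 2 φ0
      = WithLp.toLp 2 (fun v => f v - ip φ0 f * φ0 v) := by
    rw [← ip_eq]
    ext v
    simp
  rw [hgdef, ← nsq_eq, ← nsq_eq, ← nsq_eq, ← ip_eq] at key
  have hgrad : gradSq w (fun v => f v - ip φ0 f * φ0 v) = gradSq w f := by
    simp [gradSq, hφ0]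
  have hsum : ∑ v, (f v - ip φ0 f * φ0 v) = 0 := by
    have hs : ((Real.sqrt (Fintype.card V) : ℝ) : ℂ) ^ 2 = (Fintype.card V : ℂ) := by
      exact_mod_cast Real.sq_sqrt hn.le
    have hs0 : ((Real.sqrt (Fintype.card V) : ℝ) : ℂ) ≠ 0 := by
      exact_mod_cast (Real.sqrt_pos.2 hn).ne'
    simp only [ip, hφ0, Complex.conj_ofReal, ← Finset.mul_sum, Finset.sum_sub_distrib,
      Finset.sum_const, Finset.card_univ, nsmul_eq_mul, ← hs]
    push_cast
    field_simp
    ring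
  have hp := poincare_zero_mean w hsymm hnn hconn lam1 hlam _ hsum
  rw [hgrad] at hp
  have hs : 0 < ‖ip ψ φ0‖ ^ 2 := by positivity
  have hψ : 0 ≤ nsq ψ := Finset.sum_nonneg fun _ _ => by positivity
  rw [div_div, div_mul_eq_mul_div, le_div_iff₀ (by positivity)]
  nlinarith [mul_le_mul_of_nonneg_left hp hψ, mul_le_mul_of_nonneg_right key hl.le]
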